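/- Let A and B be n×n complex positive definite matrices and set C = A^{-1}(A#B). Then the geometric mean map G(A,B) = A#B is (real) Fréchet differentiable at (A,B), and its derivative DG(A,B) is given as follows: for all Hermitian matrices X, Y, the integral ∫₀^∞ exp(-t C*) (Y + C* X C) exp(-t C) dt converges and equals DG(A,B)(X,Y). -/

import Mathlib

open Matrix MeasureTheory Real
open scoped Matrix.Norms.L2Operator ComplexOrder

-- the former Mathlib definition `Matrix.PosSemidef.sqrt`, since removed
noncomputable def Matrix.PosSemidef.sqrt {n : ℕ} {A : Matrix (Fin n) (Fin n) ℂ}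
    (hA : A.PosSemidef) : Matrix (Fin n) (Fin n) ℂ :=
  hA.1.eigenvectorUnitary.1 * diagonal ((↑) ∘ Real.sqrt ∘ hA.1.eigenvalues) *
    (star hA.1.eigenvectorUnitary : Matrix (Fin n) (Fin n) ℂ)

-- `psqrt M` is the unique positive semidefinite square root of a positive semidefinite matrix
open Classical in
noncomputable def psqrt {n : ℕ} (M : Matrix (Fin n) (Fin n) ℂ) : Matrix (Fin n) (Fin n) ℂ :=
  if h : M.PosSemidef then h.sqrt else 0

-- the geometric mean  A#B = A^{1/2} (A^{-1/2} B A^{-1/2})^{1/2} A^{1/2}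
noncomputable def gm {n : ℕ} (A B : Matrix (Fin n) (Fin n) ℂ) : Matrix (Fin n) (Fin n) ℂ :=
  psqrt A * psqrt ((psqrt A)⁻¹ * B * (psqrt A)⁻¹) * psqrt A

-- entrywise complex conjugate
def mconj {n : ℕ} (M : Matrix (Fin n) (Fin n) ℂ) : Matrix (Fin n) (Fin n) ℂ := Mᴴᵀ

-- smallest eigenvalue of a Hermitian matrix
noncomputable def lmin {n : ℕ} {C : Matrix (Fin n) (Fin n) ℂ} (hC : C.IsHermitian) : ℝ :=
  ⨅ i, hC.eigenvalues i

section helpers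
open Filter Topology
open Set (Ioi)

abbrev Mat (n : ℕ) := Matrix (Fin n) (Fin n) ℂ

section sqrt
open scoped MatrixOrder

variable {n : ℕ}

theorem psqrt_spec {M : Mat n} (h : M.PosSemidef) :
    (psqrt M).PosSemidef ∧ psqrt M * psqrt M = M := by
  have e : psqrt M = h.1.eigenvectorUnitary.1 * diagonal ((↑) ∘ Real.sqrt ∘ h.1.eigenvalues) *
    (star h.1.eigenvectorUnitary : Mat n) := by
    unfold psqrt
    rw [dif_pos h]; rfl
  rw [e]
  constructor
  · have hd : (diagonal ((↑) ∘ Real.sqrt ∘ h.1.eigenvalues : Fin n → ℂ)).PosSemidef := by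
      rw [posSemidef_diagonal_iff]
      intro i
      simp [Real.sqrt_nonneg]
    exact hd.mul_mul_conjTranspose_same _
  · have hu : (star h.1.eigenvectorUnitary : Mat n) * h.1.eigenvectorUnitary.1 = 1 :=
      Unitary.coe_star_mul_self _
    conv_rhs => rw [h.1.spectral_theorem]
    rw [Unitary.conjStarAlgAut_apply]
    set U := h.1.eigenvectorUnitary.1
    set V := (star h.1.eigenvectorUnitary : Mat n)
    have hd : diagonal ((↑) ∘ Real.sqrt ∘ h.1.eigenvalues : Fin n → ℂ) *
        diagonal ((↑) ∘ Real.sqrt ∘ h.1.eigenvalues : Fin n → ℂ) =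
        diagonal (RCLike.ofReal ∘ h.1.eigenvalues) := by
      rw [diagonal_mul_diagonal]
      congr 1
      funext i
      have := Real.mul_self_sqrt (h.eigenvalues_nonneg i)
      simp only [Function.comp]
      rw [← Complex.ofReal_mul, this]; rfl
    rw [← hd]
    set D := diagonal ((↑) ∘ Real.sqrt ∘ h.1.eigenvalues : Fin n → ℂ)
    calc U * D * V * (U * D * V) = U * D * (V * U) * D * V := by noncomm_ring
      _ = _ := by rw [hu]; noncomm_ring

theorem psqrt_unique {M Q : Mat n} (hQ : Q.PosSemidef) (h : Q * Q = M) : psqrt M = Q := by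
  have hM : M.PosSemidef := by
    rw [← h]
    nth_rewrite 1 [← hQ.1.eq]
    exact posSemidef_conjTranspose_mul_self Q
  obtain ⟨h1, h2⟩ := psqrt_spec hM
  rw [← CFC.sqrt_unique h (nonneg_iff_posSemidef.2 hQ),
    ← CFC.sqrt_unique h2 (nonneg_iff_posSemidef.2 h1)]

theorem psqrt_posDef {M : Mat n} (h : M.PosDef) : (psqrt M).PosDef := by
  obtain ⟨h1, h2⟩ := psqrt_spec h.posSemidef
  rw [h1.posDef_iff_isUnit]
  have := h.isUnit
  rw [← h2] at this
  exact isUnit_of_mul_isUnit_left this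

theorem posDef_nhds [NeZero n] {G : Mat n} (h : G.PosDef) :
    ∀ᶠ H in 𝓝 G, H.IsHermitian → H.PosDef := by
  have hs : IsStrictlyPositive G := isStrictlyPositive_iff_posDef.2 h
  obtain ⟨r, hr, hle⟩ := (CFC.exists_pos_algebraMap_le_iff (a := G) h.1).2
    (fun x hx => hs.spectrum_pos hx)
  filter_upwards [Metric.ball_mem_nhds G hr] with H hH hh
  have hsa : IsSelfAdjoint (H - G) := hh.sub h.1
  have h2 := hsa.neg_algebraMap_norm_le_self
  rw [Metric.mem_ball, dist_eq_norm] at hH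
  have h3 : algebraMap ℝ (Mat n) (r - ‖H - G‖) ≤ H := by
    have := add_le_add hle h2
    rw [map_sub, sub_eq_add_neg]
    simpa using this
  rw [← isStrictlyPositive_iff_posDef]
  refine IsStrictlyPositive.of_le ?_ h3
  rw [isStrictlyPositive_iff_posDef, Algebra.algebraMap_eq_smul_one]
  exact PosDef.one.smul (sub_pos.2 hH)

theorem gm_spec {A B : Mat n} (hA : A.PosDef) (hB : B.PosDef) :
    ∃ S P : Mat n, S.PosDef ∧ P.PosDef ∧ S * S = A ∧ gm A B = S * P * S ∧
      P * P = S⁻¹ * B * S⁻¹ ∧ S = psqrt A := by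
  have hS := psqrt_posDef hA
  have hM : ((psqrt A)⁻¹ * B * (psqrt A)⁻¹).PosDef := by
    have := (Matrix.IsUnit.posDef_star_left_conjugate_iff (x := B) hS.inv.isUnit).2 hB
    rwa [star_eq_conjTranspose, hS.inv.1.eq] at this
  exact ⟨psqrt A, psqrt ((psqrt A)⁻¹ * B * (psqrt A)⁻¹), hS, psqrt_posDef hM,
    (psqrt_spec hA.posSemidef).2, rfl, (psqrt_spec hM.posSemidef).2, rfl⟩

theorem gm_posDef {A B : Mat n} (hA : A.PosDef) (hB : B.PosDef) :
    (gm A B).PosDef ∧ gm A B * A⁻¹ * gm A B = B := by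
  obtain ⟨S, P, hS, hP, hSA, hg, hPP, -⟩ := gm_spec hA hB
  have hd : IsUnit S.det := (isUnit_iff_isUnit_det _).1 hS.isUnit
  constructor
  · have := (Matrix.IsUnit.posDef_star_left_conjugate_iff (x := P) hS.isUnit).2 hP
    rwa [star_eq_conjTranspose, hS.1.eq, ← hg] at this
  · rw [hg, ← hSA, Matrix.mul_inv_rev]
    calc S * P * S * (S⁻¹ * S⁻¹) * (S * P * S)
        = S * P * (S * S⁻¹) * (S⁻¹ * S) * P * S := by noncomm_ring
      _ = S * (P * P) * S := by
        rw [mul_nonsing_inv _ hd, nonsing_inv_mul _ hd]; noncomm_ring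
      _ = (S * S⁻¹) * B * (S⁻¹ * S) := by rw [hPP]; noncomm_ring
      _ = B := by rw [mul_nonsing_inv _ hd, nonsing_inv_mul _ hd]; noncomm_ring

theorem gm_unique {A B G : Mat n} (hA : A.PosDef) (hG : G.PosDef)
    (h : G * A⁻¹ * G = B) : gm A B = G := by
  have hS := psqrt_posDef hA
  have hSA := (psqrt_spec hA.posSemidef).2
  unfold gm
  set S := psqrt A
  have hd : IsUnit S.det := (isUnit_iff_isUnit_det _).1 hS.isUnit
  have hQ : (S⁻¹ * G * S⁻¹).PosDef := by
    have := (Matrix.IsUnit.posDef_star_left_conjugate_iff (x := G) hS.inv.isUnit).2 hG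
    rwa [star_eq_conjTranspose, hS.inv.1.eq] at this
  rw [psqrt_unique hQ.posSemidef]
  · calc S * (S⁻¹ * G * S⁻¹) * S = (S * S⁻¹) * G * (S⁻¹ * S) := by noncomm_ring
      _ = G := by rw [mul_nonsing_inv _ hd, nonsing_inv_mul _ hd]; noncomm_ring
  · rw [← h, ← hSA, Matrix.mul_inv_rev]
    noncomm_ring

end sqrt

section decay
variable {n : ℕ}

/-- exponential decay for matrices similar to a positive definite one -/
theorem exp_decay [NeZero n] {S P C : Mat n} (hS : IsUnit S) (hP : P.PosDef)
    (hC : C = S⁻¹ * P * S) :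
    ∃ K c : ℝ, 0 < c ∧ ∀ t : ℝ, 0 ≤ t → ‖NormedSpace.exp ((-t) • C)‖ ≤ K * Real.exp (-c * t) := by
  obtain ⟨i₀, hi₀⟩ := Finite.exists_min hP.1.eigenvalues
  set c := hP.1.eigenvalues i₀ with hc
  have hcpos : 0 < c := hP.eigenvalues_pos i₀
  have hu : IsUnit hP.1.eigenvectorUnitary.1 :=
    ⟨Unitary.toUnits hP.1.eigenvectorUnitary, rfl⟩
  have hinv : (star hP.1.eigenvectorUnitary : Mat n) = (hP.1.eigenvectorUnitary.1)⁻¹ :=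
    (inv_eq_left_inv (Unitary.coe_star_mul_self _)).symm
  have hsp := hP.1.spectral_theorem
  rw [Unitary.conjStarAlgAut_apply] at hsp
  replace hsp : P = hP.1.eigenvectorUnitary.1 * diagonal (RCLike.ofReal ∘ hP.1.eigenvalues) *
    (hP.1.eigenvectorUnitary.1)⁻¹ := by rw [← hinv]; exact hsp
  set U := hP.1.eigenvectorUnitary.1
  set d := hP.1.eigenvalues
  refine ⟨‖S⁻¹‖ * ‖U‖ * ‖U⁻¹‖ * ‖S‖, c, hcpos, fun t ht => ?_⟩
  have e : (-t) • C = S⁻¹ * (U * diagonal (fun i => ((-t * d i : ℝ) : ℂ)) * U⁻¹) * S := by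
    have hd : diagonal (fun i => ((-t * d i : ℝ) : ℂ)) =
        (-t) • diagonal (RCLike.ofReal ∘ d : Fin n → ℂ) := by
      rw [← diagonal_smul]
      congr 1
      funext i
      simp
    rw [hC, hd]
    conv_lhs => rw [hsp]
    simp only [Matrix.mul_smul, Matrix.smul_mul]
  rw [e, Matrix.exp_conj' _ _ hS, Matrix.exp_conj _ _ hu, Matrix.exp_diagonal]
  have hD : ‖diagonal (NormedSpace.exp (fun i => ((-t * d i : ℝ) : ℂ)))‖ ≤ Real.exp (-c * t) := by
    rw [l2_opNorm_diagonal, pi_norm_le_iff_of_nonneg (Real.exp_pos _).le]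
    intro i
    rw [Pi.coe_exp, ← Complex.exp_eq_exp_ℂ, Complex.norm_exp_ofReal]
    apply Real.exp_le_exp.2
    have := mul_le_mul_of_nonneg_right (hi₀ i) ht
    linarith
  set D := diagonal (NormedSpace.exp (fun i => ((-t * d i : ℝ) : ℂ)))
  calc ‖S⁻¹ * (U * D * U⁻¹) * S‖ ≤ ‖S⁻¹‖ * ((‖U‖ * ‖D‖) * ‖U⁻¹‖) * ‖S‖ := by
        refine (norm_mul_le _ _).trans ?_
        gcongr
        refine (norm_mul_le _ _).trans ?_
        gcongr
        refine (norm_mul_le _ _).trans ?_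
        gcongr
        exact norm_mul_le _ _
    _ ≤ ‖S⁻¹‖ * ((‖U‖ * Real.exp (-c * t)) * ‖U⁻¹‖) * ‖S‖ := by gcongr
    _ = _ := by ring

theorem sandwich_bound {C : Mat n} {K c : ℝ} (hc : 0 < c)
    (h : ∀ t : ℝ, 0 ≤ t → ‖NormedSpace.exp ((-t) • C)‖ ≤ K * Real.exp (-c * t)) (M : Mat n)
    (t : ℝ) (ht : 0 ≤ t) :
    ‖NormedSpace.exp ((-t) • Cᴴ) * M * NormedSpace.exp ((-t) • C)‖ ≤
      (K * K * ‖M‖) * Real.exp (-(2 * c) * t) := by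
  have h1 := h t ht
  have h2 : ‖NormedSpace.exp ((-t) • Cᴴ)‖ ≤ K * Real.exp (-c * t) := by
    have : (-t) • Cᴴ = ((-t) • C)ᴴ := by rw [conjTranspose_smul]; simp
    rw [this, Matrix.exp_conjTranspose, l2_opNorm_conjTranspose]
    exact h1
  have h3 := (norm_nonneg _).trans h1
  have e : Real.exp (-(2 * c) * t) = Real.exp (-c * t) * Real.exp (-c * t) := by
    rw [← Real.exp_add]; congr 1; ring
  calc _ ≤ ‖NormedSpace.exp ((-t) • Cᴴ)‖ * ‖M‖ * ‖NormedSpace.exp ((-t) • C)‖ :=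
        (norm_mul_le _ _).trans (by gcongr; exact norm_mul_le _ _)
    _ ≤ (K * Real.exp (-c * t)) * ‖M‖ * (K * Real.exp (-c * t)) := by gcongr
    _ = _ := by rw [e]; ring

theorem sandwich_deriv (C E : Mat n) (t : ℝ) :
    HasDerivAt (fun t : ℝ => NormedSpace.exp ((-t) • Cᴴ) * E * NormedSpace.exp ((-t) • C))
      (-(NormedSpace.exp ((-t) • Cᴴ) * (E * C + Cᴴ * E) * NormedSpace.exp ((-t) • C))) t := by
  have h1 : HasDerivAt (fun t : ℝ => NormedSpace.exp ((-t) • Cᴴ))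
      (NormedSpace.exp ((-t) • Cᴴ) * (-Cᴴ)) t := by
    have := hasDerivAt_exp_smul_const (𝕂 := ℝ) (-Cᴴ) t
    simpa only [smul_neg, ← neg_smul] using this
  have h2 : HasDerivAt (fun t : ℝ => NormedSpace.exp ((-t) • C))
      ((-C) * NormedSpace.exp ((-t) • C)) t := by
    have := hasDerivAt_exp_smul_const' (𝕂 := ℝ) (-C) t
    simpa only [smul_neg, ← neg_smul] using this
  have := (h1.mul_const E).mul h2
  convert! this using 1
  noncomm_ring

theorem sandwich_tendsto {C : Mat n} {K c : ℝ} (hc : 0 < c)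
    (h : ∀ t : ℝ, 0 ≤ t → ‖NormedSpace.exp ((-t) • C)‖ ≤ K * Real.exp (-c * t)) (M : Mat n) :
    Tendsto (fun t : ℝ => NormedSpace.exp ((-t) • Cᴴ) * M * NormedSpace.exp ((-t) • C))
      atTop (𝓝 0) := by
  have h0 : Tendsto (fun t : ℝ => (K * K * ‖M‖) * Real.exp (-(2 * c) * t)) atTop (𝓝 0) := by
    have : Tendsto (fun t : ℝ => Real.exp (-(2 * c) * t)) atTop (𝓝 0) :=
      Real.tendsto_exp_atBot.comp (tendsto_id.const_mul_atTop_of_neg (by linarith))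
    simpa using this.const_mul (K * K * ‖M‖)
  refine squeeze_zero_norm' ?_ h0
  filter_upwards [eventually_ge_atTop 0] with t ht
  exact sandwich_bound hc h M t ht

theorem sandwich_integrable {C : Mat n} {K c : ℝ} (hc : 0 < c)
    (h : ∀ t : ℝ, 0 ≤ t → ‖NormedSpace.exp ((-t) • C)‖ ≤ K * Real.exp (-c * t)) (M : Mat n) :
    IntegrableOn (fun t : ℝ => NormedSpace.exp ((-t) • Cᴴ) * M * NormedSpace.exp ((-t) • C))
      (Ioi 0) := by
  have hcont : Continuous
      (fun t : ℝ => NormedSpace.exp ((-t) • Cᴴ) * M * NormedSpace.exp ((-t) • C)) :=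
    continuous_iff_continuousAt.2 fun t => (sandwich_deriv C M t).continuousAt
  refine Integrable.mono' ((exp_neg_integrableOn_Ioi 0 (b := 2 * c) (by linarith)).const_mul
    (K * K * ‖M‖)) hcont.aestronglyMeasurable ?_
  refine (ae_restrict_iff' measurableSet_Ioi).2 (Eventually.of_forall fun t ht => ?_)
  exact sandwich_bound hc h M t (le_of_lt ht)

theorem sandwich_integral {C E M : Mat n} {K c : ℝ} (hc : 0 < c)
    (h : ∀ t : ℝ, 0 ≤ t → ‖NormedSpace.exp ((-t) • C)‖ ≤ K * Real.exp (-c * t))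
    (hE : E * C + Cᴴ * E = M) :
    ∫ t in Ioi (0 : ℝ), NormedSpace.exp ((-t) • Cᴴ) * M * NormedSpace.exp ((-t) • C) = E := by
  have := integral_Ioi_of_hasDerivAt_of_tendsto' (a := 0)
    (fun t _ => sandwich_deriv C E t) (by rw [hE]; exact (sandwich_integrable hc h M).neg)
    (sandwich_tendsto hc h E)
  rw [hE, integral_neg] at this
  simpa [NormedSpace.exp_zero] using this

end decay

theorem gm_decay {n : ℕ} [NeZero n] {A B C : Mat n} (hA : A.PosDef) (hB : B.PosDef)
    (hC : C = A⁻¹ * gm A B) : ∃ K c : ℝ, 0 < c ∧ ∀ t : ℝ, 0 ≤ t →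
      ‖NormedSpace.exp ((-t) • C)‖ ≤ K * Real.exp (-c * t) := by
  obtain ⟨S, P, hS, hP, hSA, hg, -, -⟩ := gm_spec hA hB
  have hd : IsUnit S.det := (isUnit_iff_isUnit_det _).1 hS.isUnit
  refine exp_decay hS.isUnit hP ?_
  rw [hC, hg, ← hSA, Matrix.mul_inv_rev]
  calc S⁻¹ * S⁻¹ * (S * P * S) = S⁻¹ * (S⁻¹ * S) * P * S := by noncomm_ring
    _ = _ := by rw [nonsing_inv_mul _ hd]; noncomm_ring

section main
variable {n : ℕ}

theorem gm_main [NeZero n] (A B : Mat n)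
    (hA : A.PosDef) (hB : B.PosDef) (C : Mat n) (hC : C = A⁻¹ * gm A B) :
    ∃ D : Mat n × Mat n →L[ℝ] Mat n,
      HasFDerivWithinAt (fun p : Mat n × Mat n => gm p.1 p.2) D
        {p : Mat n × Mat n | p.1.IsHermitian ∧ p.2.IsHermitian} (A, B) ∧
      ∀ X Y : Mat n,
        D (X, Y) * C + Cᴴ * D (X, Y) = Y + Cᴴ * X * C := by
  obtain ⟨K, c, hc, hdec⟩ : ∃ K c : ℝ, 0 < c ∧ ∀ t : ℝ, 0 ≤ t →
      ‖NormedSpace.exp ((-t) • C)‖ ≤ K * Real.exp (-c * t) := gm_decay hA hB hC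
  obtain ⟨hG, hGB⟩ := gm_posDef hA hB
  set G := gm A B with hGdef
  have hCs : Cᴴ = G * A⁻¹ := by
    rw [hC, conjTranspose_mul, hG.1.eq, hA.inv.1.eq]
  obtain ⟨u, hu⟩ := hA.isUnit
  have huinv : ((u⁻¹ : (Mat n)ˣ) : Mat n) = A⁻¹ := by rw [Matrix.coe_units_inv, hu]
  -- the Riccati map
  let F : Mat n × Mat n → Mat n × Mat n := fun p => (p.1, p.2 * Ring.inverse p.1 * p.2)
  have hFval : ∀ p, F p = (p.1, p.2 * p.1⁻¹ * p.2) := fun p => by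
    simp only [F, Matrix.nonsing_inv_eq_ringInverse]
  have h1 : HasStrictFDerivAt (fun p : Mat n × Mat n => p.1)
      (ContinuousLinearMap.fst ℝ (Mat n) (Mat n)) (A, G) := hasStrictFDerivAt_fst
  have h2 : HasStrictFDerivAt (fun p : Mat n × Mat n => p.2)
      (ContinuousLinearMap.snd ℝ (Mat n) (Mat n)) (A, G) := hasStrictFDerivAt_snd
  have h3 : HasStrictFDerivAt (Ring.inverse : Mat n → Mat n)
      (-ContinuousLinearMap.mulLeftRight ℝ (Mat n) A⁻¹ A⁻¹) A := by
    have := hasStrictFDerivAt_ringInverse (𝕜 := ℝ) u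
    rwa [huinv, hu] at this
  have h4 := h3.comp (A, G) h1
  have hF := h1.prodMk ((h2.mul' h4).mul' h2)
  obtain ⟨L, hF, hLval⟩ : ∃ L : Mat n × Mat n →L[ℝ] Mat n × Mat n,
      HasStrictFDerivAt F L (A, G) ∧
      ∀ X E : Mat n, L (X, E) = (X, E * C + Cᴴ * E - Cᴴ * X * C) := by
    refine ⟨_, hF, fun X E => ?_⟩
    have hri : Ring.inverse A = A⁻¹ := (Matrix.nonsing_inv_eq_ringInverse A).symm
    refine Prod.ext rfl ?_
    rw [hCs, hC]
    simp [hri]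
    noncomm_ring
  have hinj : Function.Injective L.toLinearMap := by
    rw [injective_iff_map_eq_zero]
    rintro ⟨X, E⟩ h
    replace h : L (X, E) = 0 := h
    rw [hLval, Prod.mk_eq_zero] at h
    obtain ⟨rfl, h⟩ := h
    have h' : E * C + Cᴴ * E = 0 := by simpa using h
    have := sandwich_integral hc hdec h'
    simp at this
    rw [← this]; rfl
  let e : (Mat n × Mat n) ≃L[ℝ] (Mat n × Mat n) :=
    (LinearEquiv.ofInjectiveEndo L.toLinearMap hinj).toContinuousLinearEquiv
  have he : (e : Mat n × Mat n →L[ℝ] Mat n × Mat n) = L := by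
    ext1 <;> rfl
  replace hF : HasStrictFDerivAt F (e : Mat n × Mat n →L[ℝ] Mat n × Mat n) (A, G) := by
    rw [he]; exact hF
  have hFG : F (A, G) = (A, B) := by rw [hFval]; simp only [hGB]
  have hinv := hF.to_localInverse
  have hleft := hF.eventually_left_inverse
  have hright := hF.eventually_right_inverse
  have htend := hF.localInverse_tendsto
  set φ := hF.localInverse F e (A, G)
  have hφG : φ (F (A, G)) = (A, G) := hF.localInverse_apply_image
  rw [hFG] at hinv hright htend hφG
  refine ⟨(ContinuousLinearMap.snd ℝ (Mat n) (Mat n)).comp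
    (e.symm : Mat n × Mat n →L[ℝ] Mat n × Mat n), ?_, ?_⟩
  · have hd : HasFDerivAt (fun p => (φ p).2) ((ContinuousLinearMap.snd ℝ (Mat n) (Mat n)).comp
        (e.symm : Mat n × Mat n →L[ℝ] Mat n × Mat n)) (A, B) :=
      (hasFDerivAt_snd (𝕜 := ℝ) (p := φ (A, B))).comp (A, B) hinv.hasFDerivAt
    refine hd.hasFDerivWithinAt.congr_of_eventuallyEq ?_ ?_
    · have t1 : Tendsto (fun p : Mat n × Mat n => (φ p).2) (𝓝 (A, B)) (𝓝 G) :=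
        (continuous_snd.tendsto (A, G)).comp htend
      have t2 : Tendsto (fun p : Mat n × Mat n => (p.1, ((φ p).2)ᴴ)) (𝓝 (A, B)) (𝓝 (A, G)) := by
        refine (continuous_fst.tendsto (A, B)).prodMk_nhds ?_
        have := (continuous_id.matrix_conjTranspose.tendsto G).comp t1
        simp only [id, hG.1.eq] at this
        exact this
      have e1 := (continuous_fst.tendsto (A, B)).eventually (posDef_nhds hA)
      have e2 := t1.eventually (posDef_nhds hG)
      have e3 := t2.eventually hleft
      have e4 := hright
      have e5 := (e1.and (e2.and (e3.and e4))).filter_mono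
        (nhdsWithin_le_nhds (s := {p : Mat n × Mat n | p.1.IsHermitian ∧ p.2.IsHermitian}))
      · filter_upwards [self_mem_nhdsWithin, e5] with p hp ⟨q1, q2, q3, q4⟩
        obtain ⟨hp1, hp2⟩ := hp
        rw [hFval] at q4 q3
        have r1 : (φ p).1 = p.1 := (Prod.ext_iff.1 q4).1
        have r2 : (φ p).2 * p.1⁻¹ * (φ p).2 = p.2 := by
          rw [← r1]; exact (Prod.ext_iff.1 q4).2
        have r3 : ((φ p).2)ᴴ * p.1⁻¹ * ((φ p).2)ᴴ = p.2 := by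
          have := congrArg conjTranspose r2
          rw [conjTranspose_mul, conjTranspose_mul, hp2.eq, hp1.inv.eq] at this
          rw [← this, Matrix.mul_assoc]
        simp only [r3] at q3
        have r4 : ((φ p).2).IsHermitian := by
          have := congrArg Prod.snd q3
          exact this.symm
        exact gm_unique (q1 hp1) (q2 r4) r2
    · simp only [hφG]; rfl
  · intro X Y
    set q := e.symm (X, Y) with hq
    have : L q = (X, Y) := by
      rw [← he]; exact e.apply_symm_apply _
    obtain ⟨X', E⟩ := q
    rw [hLval, Prod.mk.injEq] at this
    obtain ⟨rfl, h⟩ := this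
    have hs : ((ContinuousLinearMap.snd ℝ (Mat n) (Mat n)).comp
      (e.symm : Mat n × Mat n →L[ℝ] Mat n × Mat n)) (X', Y) = E := by
      have := congrArg Prod.snd hq
      exact this.symm
    rw [hs, ← h]
    abel
end main
end helpers
/-- the geometric mean map is Fréchet differentiable at a pair of positive
definite matrices (within the real subspace of pairs of Hermitian matrices), and its
derivative is given by the convergent integral
`∫₀^∞ exp(-t C*) (Y + C* X C) exp(-t C) dt`, where `C = A⁻¹ (A#B)`. -/
theorem stmt0 {n : ℕ} (hn : 0 < n) (A B : Matrix (Fin n) (Fin n) ℂ)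
    (hA : A.PosDef) (hB : B.PosDef)
    (C : Matrix (Fin n) (Fin n) ℂ) (hC : C = A⁻¹ * gm A B) :
    ∃ D : Matrix (Fin n) (Fin n) ℂ × Matrix (Fin n) (Fin n) ℂ →L[ℝ] Matrix (Fin n) (Fin n) ℂ,
      HasFDerivWithinAt (fun p : Matrix (Fin n) (Fin n) ℂ × Matrix (Fin n) (Fin n) ℂ => gm p.1 p.2) D
        {p : Matrix (Fin n) (Fin n) ℂ × Matrix (Fin n) (Fin n) ℂ |
          p.1.IsHermitian ∧ p.2.IsHermitian} (A, B) ∧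
      ∀ X Y : Matrix (Fin n) (Fin n) ℂ, X.IsHermitian → Y.IsHermitian →
        IntegrableOn
          (fun t : ℝ => NormedSpace.exp ((-t) • Cᴴ) * (Y + Cᴴ * X * C) *
            NormedSpace.exp ((-t) • C)) (Set.Ioi 0) ∧
        (∫ t in Set.Ioi (0 : ℝ), NormedSpace.exp ((-t) • Cᴴ) * (Y + Cᴴ * X * C) *
            NormedSpace.exp ((-t) • C)) = D (X, Y) := by

  have : NeZero n := ⟨hn.ne'⟩
  obtain ⟨D, hD, h⟩ := gm_main A B hA hB C hC
  obtain ⟨K, c, hc, hdec⟩ := gm_decay hA hB hC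
  refine ⟨D, hD, fun X Y _ _ => ⟨sandwich_integrable hc hdec _, ?_⟩⟩
  exact sandwich_integral hc hdec (h X Y)
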